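/- Let p be a prime, n an even positive integer, and s, m positive integers with s ≤ n/2, s ∣ m and s ≠ m. Let ε ∈ {1,−1} with ε = 1 if p = 2. For each i ∈ K, let F(i;·) : V_n → K be a vectorial dual-bent function satisfying Condition A with sign ε (with respect to the inner product ⟨a,x⟩ on V_n). Let α, β ∈ M be linearly independent over K, let R : M → M be a bijection with R(0) = 0, and let T : K → K be an arbitrary function. Define H : V_n × M × M → K by H(x,y₁,y₂) = F(Tr^m_s(α·R(y₁·y₂^{p^m−2})); x) + Tr^m_s(β·R(y₁·y₂^{p^m−2})) + T(Tr^m_s(α·R(y₁·y₂^{p^m−2}))) (note y₂^{p^m−2} = y₂⁻¹ for y₂ ≠ 0 and = 0 for y₂ = 0). Then H is a vectorial dual-bent function satisfying Condition A with sign ε on the (n+2m)-dimensional space V_n × M × M with inner product ⟨(a,b₁,b₂),(x,y₁,y₂)⟩ = ⟨a,x⟩ + Tr^m_1(b₁y₁ + b₂y₂): there exists H* : V_n × M × M → K such that for all c ∈ K \ {0} and all (a,b₁,b₂), W_{H_c}(a,b₁,b₂) = ε·p^{n/2+m}·ζ_p^{Tr^s_1(c·H*(a,b₁,b₂))}. Moreover,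 the fiber partition {H⁻¹(i) : i ∈ K} is a bent partition satisfying Condition C with sign ε: H(a•z) = H(z) for every a ∈ (ZMod p)ˣ and z ∈ V_n × M × M, and for every g : K → ZMod p each of whose fibers has exactly p^{s−1} elements, g ∘ H is weakly regular bent with sign ε. -/

import Mathlib

open Finset

/-- `ζ_p^t = exp(2πi·t.val/p)` for `t : ZMod p`. -/
noncomputable def zetaP (p : ℕ) (t : ZMod p) : ℂ :=
  Complex.exp (2 * Real.pi * Complex.I * (t.val : ℂ) / (p : ℂ))

noncomputable instance (p n : ℕ) [Fact p.Prime] : Fintype (GaloisField p n) :=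
  Fintype.ofFinite _

/-- The absolute trace of `GaloisField p m` down to `ZMod p`. -/
noncomputable def absTr (p m : ℕ) [Fact p.Prime] (x : GaloisField p m) : ZMod p :=
  Algebra.trace (ZMod p) (GaloisField p m) x

/-- The standard inner product on `V_n = Fin n → ZMod p`. -/
def ip {p n : ℕ} (a x : Fin n → ZMod p) : ZMod p := ∑ i, a i * x i

section WalshTransforms

open Polynomial

variable {p : ℕ} [Fact p.Prime]

theorem zetaP_eq_stdAddChar (t : ZMod p) : zetaP p t = ZMod.stdAddChar t := by
  rw [ZMod.stdAddChar_apply, ZMod.toCircle_apply, zetaP]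

theorem zetaP_zero : zetaP p 0 = 1 := by
  rw [zetaP_eq_stdAddChar, AddChar.map_zero_eq_one]

theorem zetaP_add (a b : ZMod p) : zetaP p (a + b) = zetaP p a * zetaP p b := by
  simp only [zetaP_eq_stdAddChar, AddChar.map_add_eq_mul]

theorem zetaP_sub (a b : ZMod p) : zetaP p (a - b) = zetaP p a * zetaP p (-b) := by
  rw [sub_eq_add_neg, zetaP_add]

theorem zetaP_injective : Function.Injective (zetaP p) := fun a b h ↦
  ZMod.injective_stdAddChar (by simpa only [zetaP_eq_stdAddChar] using h)

theorem zetaP_eq_pow (t : ZMod p) : zetaP p t = zetaP p 1 ^ t.val := by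
  rw [zetaP_eq_stdAddChar, zetaP_eq_stdAddChar, ← AddChar.map_nsmul_eq_pow]
  simp

theorem zetaP_mul (u t : ZMod p) : zetaP p (u * t) = (zetaP p 1 ^ u.val) ^ t.val := by
  rw [← zetaP_eq_pow, zetaP_eq_stdAddChar, zetaP_eq_stdAddChar, ← AddChar.map_nsmul_eq_pow]
  simp [mul_comm]

theorem isPrimitiveRoot_zetaP_one : IsPrimitiveRoot (zetaP p 1) p := by
  have h : zetaP p 1 = Complex.exp (2 * Real.pi * Complex.I / p) := by
    rw [zetaP, ZMod.val_one, Nat.cast_one, mul_one]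
  rw [h]
  exact Complex.isPrimitiveRoot_exp p (Fact.out : p.Prime).ne_zero

/-- The Galois automorphism `ζ ↦ ζ ^ u` preserves relations between sums of roots of unity. -/
theorem sum_zetaP_mul_of_sum_zetaP {W : Type*} [Fintype W] (f : W → ZMod p) (N : ℤ) (d u : ZMod p)
    (hu : u ≠ 0) (h : ∑ x, zetaP p (f x) = N * zetaP p d) :
    ∑ x, zetaP p (u * f x) = N * zetaP p (u * d) := by
  have hprim := isPrimitiveRoot_zetaP_one (p := p)
  have hpos : 0 < p := (Fact.out : p.Prime).pos
  let P : ℤ[X] := ∑ x, X ^ (f x).val - C N * X ^ d.val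
  have heval (z : ℂ) : aeval z P = ∑ x, z ^ (f x).val - N * z ^ d.val := by
    simp [P]
  have hroot : aeval (zetaP p 1) P = 0 := by
    simp only [zetaP_eq_pow (p := p) (f _), zetaP_eq_pow (p := p) d] at h
    rw [heval, h, sub_self]
  have hcop : Nat.Coprime u.val p := by
    refine ((Fact.out : p.Prime).coprime_iff_not_dvd.2 fun hdvd ↦ hu ?_).symm
    rw [← ZMod.natCast_zmod_val u]
    exact (ZMod.natCast_eq_zero_iff _ _).2 hdvd
  have hdvd : minpoly ℤ (zetaP p 1 ^ u.val) ∣ P := by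
    rw [← hprim.minpoly_eq_pow_coprime hcop]
    exact minpoly.isIntegrallyClosed_dvd (hprim.isIntegral hpos) hroot
  have hroot' : aeval (zetaP p 1 ^ u.val) P = 0 := by
    obtain ⟨Q, hQ⟩ := hdvd
    rw [hQ, map_mul, minpoly.aeval, zero_mul]
  rw [heval, sub_eq_zero] at hroot'
  simpa only [zetaP_mul] using hroot'

/-- The sum of a nontrivial character over a finite group vanishes. -/
theorem sum_zetaP_addMonoidHom {A : Type*} [AddCommGroup A] [Fintype A] (φ : A →+ ZMod p)
    (h : ∃ a, φ a ≠ 0) : ∑ a, zetaP p (φ a) = 0 := by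
  obtain ⟨a, ha⟩ := h
  have hψ : (ZMod.stdAddChar (N := p)).compAddMonoidHom φ ≠ 0 := by
    rw [AddChar.ne_zero_iff]
    refine ⟨a, fun h1 ↦ ha (ZMod.injective_stdAddChar ?_)⟩
    rw [AddChar.map_zero_eq_one]
    exact h1
  simpa only [zetaP_eq_stdAddChar, AddChar.compAddMonoidHom_apply] using
    AddChar.sum_eq_zero_iff_ne_zero.2 hψ

theorem ip_add_left {n : ℕ} (a b x : Fin n → ZMod p) : ip (a + b) x = ip a x + ip b x := by
  simp [ip, add_mul, Finset.sum_add_distrib]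

theorem ip_sub_right {n : ℕ} (a x y : Fin n → ZMod p) : ip a (x - y) = ip a x - ip a y := by
  simp [ip, mul_sub, Finset.sum_sub_distrib]

theorem ip_smul_left {n : ℕ} (u : ZMod p) (a x : Fin n → ZMod p) :
    ip (u • a) x = u * ip a x := by
  simp [ip, Finset.mul_sum, mul_assoc]

theorem ip_smul_right {n : ℕ} (u : ZMod p) (a x : Fin n → ZMod p) :
    ip a (u • x) = u * ip a x := by
  simp [ip, Finset.mul_sum, mul_left_comm]

theorem sum_zetaP_ip {n : ℕ} (x : Fin n → ZMod p) :
    ∑ a, zetaP p (ip a x) = if x = 0 then (p : ℂ) ^ n else 0 := by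
  split_ifs with hx
  · simp [hx, ip, zetaP_zero, ZMod.card]
  · obtain ⟨i, hi⟩ := Function.ne_iff.1 hx
    refine sum_zetaP_addMonoidHom (AddMonoidHom.mk' (fun a ↦ ip a x) fun a b ↦ ip_add_left a b x)
      ⟨Pi.single i 1, ?_⟩
    simpa [ip, Pi.single_apply] using hi

/-- The Walsh transform is injective. -/
theorem eq_of_walsh_eq {n : ℕ} (f g : (Fin n → ZMod p) → ZMod p)
    (h : ∀ a, ∑ x, zetaP p (f x - ip a x) = ∑ x, zetaP p (g x - ip a x)) : f = g := by
  have key (f : (Fin n → ZMod p) → ZMod p) (y : Fin n → ZMod p) :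
      ∑ a, zetaP p (ip a y) * ∑ x, zetaP p (f x - ip a x) = (p : ℂ) ^ n * zetaP p (f y) := by
    simp_rw [Finset.mul_sum]
    rw [Finset.sum_comm]
    have (x : Fin n → ZMod p) : ∑ a, zetaP p (ip a y) * zetaP p (f x - ip a x) =
        zetaP p (f x) * if y - x = 0 then (p : ℂ) ^ n else 0 := by
      rw [← sum_zetaP_ip, Finset.mul_sum]
      refine Finset.sum_congr rfl fun a _ ↦ ?_
      rw [← zetaP_add, ← zetaP_add, ip_sub_right]
      congr 1
      ring
    simp_rw [this, sub_eq_zero]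
    simp [mul_comm]
  funext y
  have h1 := key f y
  simp_rw [h] at h1
  rw [key g y] at h1
  have hp : (p : ℂ) ^ n ≠ 0 := pow_ne_zero _ (Nat.cast_ne_zero.2 (Fact.out : p.Prime).ne_zero)
  exact (zetaP_injective (mul_left_cancel₀ hp h1)).symm

theorem absTr_add {s : ℕ} (x y : GaloisField p s) :
    absTr p s (x + y) = absTr p s x + absTr p s y :=
  map_add _ _ _

theorem absTr_neg {s : ℕ} (x : GaloisField p s) : absTr p s (-x) = -absTr p s x :=
  map_neg _ _

theorem absTr_zero {s : ℕ} : absTr p s 0 = 0 :=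
  map_zero _

theorem absTr_smul {s : ℕ} (u : ZMod p) (x : GaloisField p s) :
    absTr p s (u • x) = u * absTr p s x :=
  map_smul _ _ _

theorem exists_absTr_mul_ne_zero {s : ℕ} {x : GaloisField p s} (hx : x ≠ 0) :
    ∃ c, absTr p s (c * x) ≠ 0 := by
  by_contra! h
  refine hx ((traceForm_nondegenerate (ZMod p) (GaloisField p s)).1 x fun c ↦ ?_)
  rw [Algebra.traceForm_apply, mul_comm]
  exact h c

theorem eq_of_absTr_mul_eq {s : ℕ} {x y : GaloisField p s}
    (h : ∀ c : GaloisField p s, c ≠ 0 → absTr p s (c * x) = absTr p s (c * y)) : x = y := by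
  by_contra hxy
  obtain ⟨c, hc⟩ := exists_absTr_mul_ne_zero (sub_ne_zero.2 hxy)
  refine hc ?_
  by_cases hc0 : c = 0
  · rw [hc0, zero_mul, absTr_zero]
  · rw [mul_sub, sub_eq_add_neg, absTr_add, absTr_neg, h c hc0, add_neg_cancel]

theorem card_galoisField {s : ℕ} (hs : s ≠ 0) : Fintype.card (GaloisField p s) = p ^ s := by
  rw [← Nat.card_eq_fintype_card, GaloisField.card p s hs]

open scoped Classical in
theorem sum_zetaP_absTr_mul {s : ℕ} (hs : s ≠ 0) (x : GaloisField p s) :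
    ∑ c, zetaP p (absTr p s (c * x)) = if x = 0 then (p : ℂ) ^ s else 0 := by
  split_ifs with hx
  · simp [hx, absTr_zero, zetaP_zero, card_galoisField hs]
  · exact sum_zetaP_addMonoidHom (AddMonoidHom.mk' (fun c ↦ absTr p s (c * x)) fun a b ↦ by
      rw [add_mul, absTr_add]) (exists_absTr_mul_ne_zero hx)

/-- A vectorial dual-bent function in even dimension satisfying Condition A is constant on the
nonzero points of each `𝔽_p`-line. -/
theorem smul_invariant_of_dualBent {n s k : ℕ} {ε : ℤ} (hε : ε ≠ 0)
    (f fd : (Fin n → ZMod p) → GaloisField p s)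
    (hf : ∀ c : GaloisField p s, c ≠ 0 → ∀ a, ∑ x, zetaP p (absTr p s (c * f x) - ip a x) =
      (ε : ℂ) * (p : ℂ) ^ k * zetaP p (absTr p s (c * fd a)))
    {u : ZMod p} (hu : u ≠ 0) (x : Fin n → ZMod p) : f (u • x) = f x := by
  have hp : (p : ℂ) ≠ 0 := Nat.cast_ne_zero.2 (Fact.out : p.Prime).ne_zero
  have hN : (ε : ℂ) * (p : ℂ) ^ k ≠ 0 := mul_ne_zero (Int.cast_ne_zero.2 hε) (pow_ne_zero _ hp)
  have hdual (v : ZMod p) (hv : v ≠ 0) (a : Fin n → ZMod p) : fd (v • a) = fd a := by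
    refine eq_of_absTr_mul_eq fun c hc ↦ ?_
    have h1 := sum_zetaP_mul_of_sum_zetaP (p := p) (fun x ↦ absTr p s (c * f x) - ip a x)
      (ε * (p : ℤ) ^ k) (absTr p s (c * fd a)) v hv (by push_cast; exact hf c hc a)
    have h2 := hf (v • c) (smul_ne_zero hv hc) (v • a)
    simp_rw [smul_mul_assoc, absTr_smul, ip_smul_left, ← mul_sub] at h2
    rw [h1] at h2
    push_cast at h2
    exact (mul_left_cancel₀ hv (zetaP_injective (mul_left_cancel₀ hN h2))).symm
  refine eq_of_absTr_mul_eq fun c hc ↦ ?_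
  refine congrFun (eq_of_walsh_eq (fun x ↦ absTr p s (c * f (u • x))) (fun x ↦ absTr p s (c * f x))
    fun a ↦ ?_) x
  rw [hf c hc a, ← hdual u⁻¹ (inv_ne_zero hu) a, ← hf c hc (u⁻¹ • a)]
  refine Fintype.sum_equiv (MulAction.toPerm (Units.mk0 u hu)) _ _ fun x ↦ ?_
  have hx : (MulAction.toPerm (Units.mk0 u hu) : Equiv.Perm (Fin n → ZMod p)) x = u • x := rfl
  rw [hx, ip_smul_left, ip_smul_right, inv_mul_cancel_left₀ hu]

/-- Condition A implies that balanced combinations of the fibers are weakly regular bent. -/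
theorem sum_zetaP_comp_of_balanced {s : ℕ} (hs : s ≠ 0) {X : Type*} [Fintype X]
    (h : X → GaloisField p s) (L : X → ZMod p) (N : ℂ) (d : GaloisField p s)
    (hh : ∀ c : GaloisField p s, c ≠ 0 →
      ∑ x, zetaP p (absTr p s (c * h x) - L x) = N * zetaP p (absTr p s (c * d)))
    (g : GaloisField p s → ZMod p) (r : ℕ)
    (hg : ∀ j : ZMod p, (Finset.univ.filter (fun i => g i = j)).card = r) :
    ∑ x, zetaP p (g (h x) - L x) = N * zetaP p (g d) := by
  classical
  have hp : (p : ℂ) ≠ 0 := Nat.cast_ne_zero.2 (Fact.out : p.Prime).ne_zero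
  let G (c : GaloisField p s) : ℂ := ∑ k, zetaP p (g k) * zetaP p (-absTr p s (c * k))
  have hG0 : G 0 = 0 := by
    have h1 : G 0 = ∑ k, zetaP p (g k) := by simp [G, absTr_zero, zetaP_zero]
    rw [h1, ← Finset.sum_fiberwise Finset.univ g]
    have h2 (j : ZMod p) : ∑ i with g i = j, zetaP p (g i) = r * zetaP p j := by
      rw [Finset.sum_congr rfl fun i hi ↦ by rw [(Finset.mem_filter.1 hi).2], Finset.sum_const,
        hg, nsmul_eq_mul]
    simp_rw [h2, ← Finset.mul_sum]
    have h3 := sum_zetaP_addMonoidHom (AddMonoidHom.id (ZMod p)) ⟨1, one_ne_zero⟩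
    simp only [AddMonoidHom.id_apply] at h3
    rw [h3, mul_zero]
  have hinv (k : GaloisField p s) :
      (p : ℂ) ^ s * zetaP p (g k) = ∑ c, G c * zetaP p (absTr p s (c * k)) := by
    simp_rw [G, Finset.sum_mul]
    rw [Finset.sum_comm]
    have (l : GaloisField p s) :
        ∑ c, zetaP p (g l) * zetaP p (-absTr p s (c * l)) * zetaP p (absTr p s (c * k)) =
          zetaP p (g l) * if k - l = 0 then (p : ℂ) ^ s else 0 := by
      rw [← sum_zetaP_absTr_mul hs, Finset.mul_sum]
      refine Finset.sum_congr rfl fun c _ ↦ ?_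
      rw [mul_assoc, ← zetaP_add, mul_sub, sub_eq_add_neg, absTr_add, absTr_neg, add_comm]
    simp_rw [this, sub_eq_zero]
    simp [mul_comm]
  refine mul_left_cancel₀ (pow_ne_zero s hp) ?_
  calc (p : ℂ) ^ s * ∑ x, zetaP p (g (h x) - L x)
      = ∑ x, ∑ c, G c * zetaP p (absTr p s (c * h x) - L x) := by
        rw [Finset.mul_sum]
        refine Finset.sum_congr rfl fun x _ ↦ ?_
        rw [zetaP_sub, ← mul_assoc, hinv, Finset.sum_mul]
        exact Finset.sum_congr rfl fun c _ ↦ by rw [zetaP_sub, mul_assoc]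
    _ = ∑ c, G c * ∑ x, zetaP p (absTr p s (c * h x) - L x) := by
        rw [Finset.sum_comm]
        simp_rw [Finset.mul_sum]
    _ = ∑ c, N * (G c * zetaP p (absTr p s (c * d))) := by
        refine Finset.sum_congr rfl fun c _ ↦ ?_
        by_cases hc : c = 0
        · simp [hc, hG0]
        · rw [hh c hc]
          ring
    _ = (p : ℂ) ^ s * (N * zetaP p (g d)) := by
        rw [← Finset.mul_sum, ← hinv]
        ring

/-- The Walsh transform of a function of `y₁ / y₂` whose values sum to zero. -/
theorem sum_sum_zetaP_div {m : ℕ} (hm : m ≠ 0) (φ : GaloisField p m → ℂ) (hφ : ∑ z, φ z = 0)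
    (b₁ b₂ : GaloisField p m) :
    ∑ y₁, ∑ y₂, φ (y₁ * y₂⁻¹) * zetaP p (-absTr p m (b₁ * y₁ + b₂ * y₂)) =
      (p : ℂ) ^ m * φ (-b₂ * b₁⁻¹) := by
  classical
  let A (y : GaloisField p m) : ℂ := ∑ z, φ z * zetaP p (absTr p m (y * -(b₁ * z + b₂)))
  have hA0 : A 0 = 0 := by simp [A, absTr_zero, zetaP_zero, hφ]
  have hzero : ∑ y, zetaP p (-absTr p m (b₁ * y)) = if b₁ = 0 then (p : ℂ) ^ m else 0 := by
    rw [← neg_eq_zero (a := b₁), ← sum_zetaP_absTr_mul hm]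
    exact Finset.sum_congr rfl fun y _ ↦ by rw [← absTr_neg, mul_neg, mul_comm b₁]
  have hy₂ (y₂ : GaloisField p m) :
      ∑ y₁, φ (y₁ * y₂⁻¹) * zetaP p (-absTr p m (b₁ * y₁ + b₂ * y₂)) =
        A y₂ + if y₂ = 0 then φ 0 * (if b₁ = 0 then (p : ℂ) ^ m else 0) else 0 := by
    split_ifs with h h'
    · simp [h, hA0, h', absTr_zero, zetaP_zero, card_galoisField hm, mul_comm]
    · have h0 := hzero.trans (if_neg h')
      simp [h, hA0, ← Finset.mul_sum, h0]
    · rw [add_zero]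
      refine Fintype.sum_equiv (Equiv.mulRight₀ y₂⁻¹ (inv_ne_zero h)) _ _ fun y₁ ↦ ?_
      rw [← absTr_neg, Equiv.mulRight₀_apply]
      congr 3
      field_simp
  rw [Finset.sum_comm]
  simp_rw [hy₂, Finset.sum_add_distrib]
  rw [Finset.sum_ite_eq' Finset.univ, if_pos (Finset.mem_univ _), Finset.sum_comm]
  simp_rw [← Finset.mul_sum, sum_zetaP_absTr_mul hm, neg_eq_zero]
  by_cases hb : b₁ = 0
  · by_cases hb₂ : b₂ = 0
    · simp [hb, hb₂, ← Finset.sum_mul, hφ, mul_comm]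
    · simp [hb, hb₂, mul_comm]
  · have (z : GaloisField p m) : b₁ * z + b₂ = 0 ↔ z = -b₂ * b₁⁻¹ := by
      rw [add_eq_zero_iff_eq_neg, ← div_eq_mul_inv, eq_div_iff hb, mul_comm]
    simp only [this]
    simp [hb, mul_comm]

end WalshTransforms

/-- Linearly independent elements `α, β` yield independent trace functionals. -/
theorem exists_trace_eq_zero_and_ne_zero {K L : Type*} [Field K] [Field L] [Algebra K L]
    [FiniteDimensional K L] [Algebra.IsSeparable K L] {α β : L}
    (h : ∀ c₁ c₂ : K, c₁ • α + c₂ • β = 0 → c₁ = 0 ∧ c₂ = 0) :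
    ∃ u : L, Algebra.trace K L (α * u) = 0 ∧ Algebra.trace K L (β * u) ≠ 0 := by
  have nondeg (a : L) (ha : ∀ u, Algebra.trace K L (a * u) = 0) : a = 0 :=
    (traceForm_nondegenerate K L).1 a fun u ↦ by rw [Algebra.traceForm_apply, ha]
  by_contra! hu
  have hα : α ≠ 0 := by
    rintro rfl
    exact one_ne_zero (h 1 0 (by simp)).1
  have : ∃ v, Algebra.trace K L (α * v) ≠ 0 := by
    by_contra! hv
    exact hα (nondeg α hv)
  obtain ⟨v, hv⟩ := this
  let a := Algebra.trace K L (α * v)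
  let b := Algebra.trace K L (β * v)
  have hzero : -b • α + a • β = 0 := by
    refine nondeg _ fun w ↦ ?_
    have hw := hu (a • w - Algebra.trace K L (α * w) • v) (by
      simp [mul_sub, a, mul_comm])
    simp only [mul_sub, mul_smul_comm, map_sub, map_smul, smul_eq_mul] at hw
    simp only [add_mul, smul_mul_assoc, map_add, map_smul, smul_eq_mul, neg_smul, neg_mul, map_neg]
    linear_combination hw
  exact hv (h _ _ hzero).2

theorem sum_mul_zetaP_trace_eq_zero {p : ℕ} [Fact p.Prime] {s : ℕ} {L : Type*} [Field L] [Fintype L]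
    [Algebra (GaloisField p s) L] {α β : L}
    (h : ∀ c₁ c₂ : GaloisField p s, c₁ • α + c₂ • β = 0 → c₁ = 0 ∧ c₂ = 0)
    (f : GaloisField p s → ℂ) {c : GaloisField p s} (hc : c ≠ 0) :
    ∑ u : L, f (Algebra.trace _ L (α * u)) *
      zetaP p (absTr p s (c * Algebra.trace (GaloisField p s) L (β * u))) = 0 := by
  obtain ⟨v, hv₁, hv₂⟩ := exists_trace_eq_zero_and_ne_zero h
  obtain ⟨k, hk⟩ := exists_absTr_mul_ne_zero (mul_ne_zero hc hv₂)
  have hshift := Equiv.sum_comp (Equiv.addRight (k • v)) fun u : L ↦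
    f (Algebra.trace _ L (α * u)) *
      zetaP p (absTr p s (c * Algebra.trace (GaloisField p s) L (β * u)))
  have hterm (u : L) : f (Algebra.trace _ L (α * (u + k • v))) *
      zetaP p (absTr p s (c * Algebra.trace (GaloisField p s) L (β * (u + k • v)))) =
      f (Algebra.trace _ L (α * u)) *
        zetaP p (absTr p s (c * Algebra.trace (GaloisField p s) L (β * u))) *
        zetaP p (absTr p s (k * (c * Algebra.trace (GaloisField p s) L (β * v)))) := by
    simp only [mul_add, mul_smul_comm, map_add, map_smul, hv₁, smul_eq_mul, mul_zero, add_zero]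
    rw [absTr_add, zetaP_add, mul_left_comm c k, mul_assoc]
  simp only [Equiv.coe_addRight, hterm, ← Finset.sum_mul] at hshift
  by_contra hS
  refine hk (zetaP_injective ?_)
  rw [zetaP_zero]
  exact mul_left_cancel₀ hS (hshift.trans (mul_one _).symm)

/-- A power sum along the Frobenius orbit is the relative trace. -/
theorem eq_trace_of_eq_sum_pow {p m s : ℕ} [Fact p.Prime] (hm : m ≠ 0) (hs : s ≠ 0)
    [Algebra (GaloisField p s) (GaloisField p m)] {z : GaloisField p m} {t : GaloisField p s}
    (h : algebraMap _ (GaloisField p m) t = ∑ j ∈ Finset.range (m / s), z ^ (p ^ s) ^ j) :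
    t = Algebra.trace _ _ z := by
  have hcard := Module.natCard_eq_pow_finrank (K := GaloisField p s) (V := GaloisField p m)
  rw [GaloisField.card p m hm, GaloisField.card p s hs, ← pow_mul] at hcard
  have hrank : m / s = Module.finrank (GaloisField p s) (GaloisField p m) := by
    have hmul := Nat.pow_right_injective (Fact.out : p.Prime).two_le hcard
    exact Nat.div_eq_of_eq_mul_right (Nat.pos_of_ne_zero hs) hmul
  refine FaithfulSMul.algebraMap_injective (GaloisField p s) (GaloisField p m) ?_
  rw [h, hrank, FiniteField.algebraMap_trace_eq_sum_pow, GaloisField.card p s hs]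

theorem stmt10 (p : ℕ) [Fact p.Prime] (n m s : ℕ) (hn : 0 < n) (hneven : Even n)
    (hm : 0 < m) (hs : 0 < s) (hsn : s ≤ n / 2) (hsm : s ∣ m) (hsne : s ≠ m)
    (ε : ℤ) (hε : ε = 1 ∨ ε = -1) (hε2 : p = 2 → ε = 1)
    -- the subfield `K` with `p^s` elements of `M = GaloisField p m`, via a ring embedding
    (ι : GaloisField p s →+* GaloisField p m)
    -- the relative trace `Tr^m_s : M → K`
    (trms : GaloisField p m → GaloisField p s)
    (htrms : ∀ z : GaloisField p m,
      ι (trms z) = ∑ j ∈ Finset.range (m / s), z ^ (p ^ s) ^ j)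
    -- for each `i ∈ K`, a vectorial dual-bent function `F(i;·) : V_n → K`
    -- satisfying Condition A with sign `ε`
    (F : GaloisField p s → (Fin n → ZMod p) → GaloisField p s)
    (hF : ∀ i : GaloisField p s, ∃ Fd : (Fin n → ZMod p) → GaloisField p s,
      ∀ c : GaloisField p s, c ≠ 0 → ∀ a : Fin n → ZMod p,
        (∑ x : Fin n → ZMod p, zetaP p (absTr p s (c * F i x) - ip a x)) =
          (ε : ℂ) * (p : ℂ) ^ (n / 2) * zetaP p (absTr p s (c * Fd a)))
    -- `α, β ∈ M` linearly independent over `K`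
    (α β : GaloisField p m)
    (hαβ : ∀ c₁ c₂ : GaloisField p s, ι c₁ * α + ι c₂ * β = 0 → c₁ = 0 ∧ c₂ = 0)
    -- a bijection `R` of `M` with `R(0) = 0`, and an arbitrary function `T : K → K`
    (R : GaloisField p m → GaloisField p m) (hR : Function.Bijective R) (hR0 : R 0 = 0)
    (T : GaloisField p s → GaloisField p s)
    -- the function `H(x,y₁,y₂)`
    (H : (Fin n → ZMod p) → GaloisField p m → GaloisField p m → GaloisField p s)
    (hH : ∀ x y₁ y₂, H x y₁ y₂ =
      F (trms (α * R (y₁ * y₂ ^ (p ^ m - 2)))) x + trms (β * R (y₁ * y₂ ^ (p ^ m - 2)))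
        + T (trms (α * R (y₁ * y₂ ^ (p ^ m - 2))))) :
    -- `H` is vectorial dual-bent satisfying Condition A with sign `ε` on `V_n × M × M`
    (∃ Hd : (Fin n → ZMod p) → GaloisField p m → GaloisField p m → GaloisField p s,
      ∀ c : GaloisField p s, c ≠ 0 →
        ∀ (a : Fin n → ZMod p) (b₁ b₂ : GaloisField p m),
          (∑ x : Fin n → ZMod p, ∑ y₁ : GaloisField p m, ∑ y₂ : GaloisField p m,
              zetaP p (absTr p s (c * H x y₁ y₂)
                - (ip a x + absTr p m (b₁ * y₁ + b₂ * y₂)))) =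
            (ε : ℂ) * (p : ℂ) ^ (n / 2 + m) * zetaP p (absTr p s (c * Hd a b₁ b₂))) ∧
    -- the fiber partition of `H` is a bent partition satisfying Condition C with sign `ε`:
    -- `H` is invariant under nonzero scalar multiplication
    (∀ (a : (ZMod p)ˣ) (x : Fin n → ZMod p) (y₁ y₂ : GaloisField p m),
      H ((a : ZMod p) • x) ((a : ZMod p) • y₁) ((a : ZMod p) • y₂) = H x y₁ y₂) ∧
    -- and every balanced combination of the fibers is weakly regular bent with sign `ε`
    (∀ g : GaloisField p s → ZMod p,
      (∀ j : ZMod p, (Finset.univ.filter (fun i => g i = j)).card = p ^ (s - 1)) →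
      ∃ hd : (Fin n → ZMod p) → GaloisField p m → GaloisField p m → ZMod p,
        ∀ (a : Fin n → ZMod p) (b₁ b₂ : GaloisField p m),
          (∑ x : Fin n → ZMod p, ∑ y₁ : GaloisField p m, ∑ y₂ : GaloisField p m,
              zetaP p (g (H x y₁ y₂)
                - (ip a x + absTr p m (b₁ * y₁ + b₂ * y₂)))) =
            (ε : ℂ) * (p : ℂ) ^ (n / 2 + m) * zetaP p (hd a b₁ b₂)) := by
  have hε0 : ε ≠ 0 := by
    rcases hε with rfl | rfl <;> decide
  have hm2 : 2 ≤ m := by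
    by_contra! hm2
    have hm1 : m = 1 := by lia
    subst hm1
    exact hsne (Nat.dvd_one.1 hsm)
  have hinv (y : GaloisField p m) : y ^ (p ^ m - 2) = y⁻¹ := by
    have h4 : 2 ^ 2 ≤ p ^ m := (Nat.pow_le_pow_right two_pos hm2).trans
      (Nat.pow_le_pow_left (Fact.out : p.Prime).two_le m)
    by_cases hy : y = 0
    · rw [hy, inv_zero, zero_pow (by lia)]
    · refine eq_inv_of_mul_eq_one_left ?_
      rw [← pow_succ, show p ^ m - 2 + 1 = p ^ m - 1 by lia, ← card_galoisField hm.ne']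
      exact FiniteField.pow_card_sub_one_eq_one y hy
  simp_rw [hinv] at hH
  let _ : Algebra (GaloisField p s) (GaloisField p m) := ι.toAlgebra
  have htr (z : GaloisField p m) : trms z = Algebra.trace _ _ z :=
    eq_trace_of_eq_sum_pow hm.ne' hs.ne' (htrms z)
  have hind (c₁ c₂ : GaloisField p s) (h : c₁ • α + c₂ • β = 0) : c₁ = 0 ∧ c₂ = 0 :=
    hαβ c₁ c₂ (by rwa [Algebra.smul_def, Algebra.smul_def] at h)
  choose Fd hFd using hF
  have hA : ∃ Hd : (Fin n → ZMod p) → GaloisField p m → GaloisField p m → GaloisField p s,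
      ∀ c : GaloisField p s, c ≠ 0 →
        ∀ (a : Fin n → ZMod p) (b₁ b₂ : GaloisField p m),
          (∑ x : Fin n → ZMod p, ∑ y₁ : GaloisField p m, ∑ y₂ : GaloisField p m,
              zetaP p (absTr p s (c * H x y₁ y₂)
                - (ip a x + absTr p m (b₁ * y₁ + b₂ * y₂)))) =
            (ε : ℂ) * (p : ℂ) ^ (n / 2 + m) * zetaP p (absTr p s (c * Hd a b₁ b₂)) := by
    let G (f : GaloisField p s → GaloisField p s) (z : GaloisField p m) : GaloisField p s :=
      f (trms (α * R z)) + trms (β * R z) + T (trms (α * R z))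
    refine ⟨fun a b₁ b₂ ↦ G (fun i ↦ Fd i a) (-b₂ * b₁⁻¹), fun c hc a b₁ b₂ ↦ ?_⟩
    let φ (z : GaloisField p m) : ℂ :=
      ∑ x, zetaP p (absTr p s (c * G (fun i ↦ F i x) z) - ip a x)
    have hφ (z : GaloisField p m) : φ z =
        (ε : ℂ) * (p : ℂ) ^ (n / 2) * zetaP p (absTr p s (c * G (fun i ↦ Fd i a) z)) := by
      simp only [φ, G, mul_add, absTr_add, zetaP_add, zetaP_sub]
      rw [← mul_assoc, ← mul_assoc, ← hFd _ c hc a, Finset.sum_mul, Finset.sum_mul]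
      refine Finset.sum_congr rfl fun x _ ↦ ?_
      rw [zetaP_sub]
      ring
    have hφ0 : ∑ z, φ z = 0 := by
      have h0 := sum_mul_zetaP_trace_eq_zero hind
        (fun i ↦ zetaP p (absTr p s (c * (Fd i a + T i)))) hc
      rw [← Equiv.sum_comp (Equiv.ofBijective R hR)] at h0
      simp_rw [hφ]
      rw [← Finset.mul_sum]
      refine mul_eq_zero_of_right _ (Eq.trans (Finset.sum_congr rfl fun z _ ↦ ?_) h0)
      simp only [G, htr, Equiv.ofBijective_apply, ← zetaP_add, ← absTr_add, ← mul_add]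
      rw [add_right_comm]
    have hsum := sum_sum_zetaP_div hm.ne' φ hφ0 b₁ b₂
    rw [hφ] at hsum
    rw [pow_add, mul_comm ((p : ℂ) ^ (n / 2)), mul_left_comm (ε : ℂ), mul_assoc, ← hsum,
      Finset.sum_comm]
    refine Finset.sum_congr rfl fun y₁ _ ↦ ?_
    rw [Finset.sum_comm]
    refine Finset.sum_congr rfl fun y₂ _ ↦ ?_
    rw [Finset.sum_mul]
    refine Finset.sum_congr rfl fun x _ ↦ ?_
    rw [hH, ← sub_sub, zetaP_sub (_ - _)]
  obtain ⟨Hd, hHd⟩ := hA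
  refine ⟨⟨Hd, hHd⟩, fun u x y₁ y₂ ↦ ?_, fun g hg ↦ ⟨fun a b₁ b₂ ↦ g (Hd a b₁ b₂),
    fun a b₁ b₂ ↦ ?_⟩⟩
  · have hu : (u : ZMod p) ≠ 0 := u.ne_zero
    have hdiv : ((u : ZMod p) • y₁) * ((u : ZMod p) • y₂)⁻¹ = y₁ * y₂⁻¹ := by
      rw [smul_inv₀, smul_mul_smul_comm, mul_inv_cancel₀ hu, one_smul]
    rw [hH, hH, hdiv, smul_invariant_of_dualBent hε0 _ _ (hFd _) hu]
  · have h := sum_zetaP_comp_of_balanced hs.ne'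
      (X := (Fin n → ZMod p) × GaloisField p m × GaloisField p m)
      (fun x ↦ H x.1 x.2.1 x.2.2) (fun x ↦ ip a x.1 + absTr p m (b₁ * x.2.1 + b₂ * x.2.2))
      _ (Hd a b₁ b₂)
      (fun c hc ↦ by simpa only [Fintype.sum_prod_type] using hHd c hc a b₁ b₂) g _ hg
    simpa only [Fintype.sum_prod_type] using h
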